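/- Let h ≥ 1 with h % 8 = 0, let β be a positive definite symmetric ℚ-bilinear form on V := Fin h → ℚ, and let L ⊆ V be an odd unimodular integral lattice with respect to β. Then the set of unimodular integral lattices N ⊆ V with N ⊓ L = M₂(L) has exactly two elements, and every such N is even. -/

import Mathlib

/-- `L` is a unimodular integral lattice w.r.t. `β` if it equals its dual lattice
`L^∨ = {v | ∀ x ∈ L, β v x ∈ ℤ}`. -/
def IsUnimodularLattice {h : ℕ} (β : (Fin h → ℚ) →ₗ[ℚ] (Fin h → ℚ) →ₗ[ℚ] ℚ)
    (L : Submodule ℤ (Fin h → ℚ)) : Prop :=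
  ∀ v : Fin h → ℚ, v ∈ L ↔ ∀ x ∈ L, ∃ n : ℤ, β v x = (n : ℚ)

/-- `L` is odd: `β x x` is an odd integer for some `x ∈ L`. -/
def IsOddLattice {h : ℕ} (β : (Fin h → ℚ) →ₗ[ℚ] (Fin h → ℚ) →ₗ[ℚ] ℚ)
    (L : Submodule ℤ (Fin h → ℚ)) : Prop :=
  ∃ x ∈ L, ∃ n : ℤ, Odd n ∧ β x x = (n : ℚ)

/-- `L` is even: `β x x` is an even integer for every `x ∈ L`. -/
def IsEvenLattice {h : ℕ} (β : (Fin h → ℚ) →ₗ[ℚ] (Fin h → ℚ) →ₗ[ℚ] ℚ)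
    (L : Submodule ℤ (Fin h → ℚ)) : Prop :=
  ∀ x ∈ L, ∃ n : ℤ, Even n ∧ β x x = (n : ℚ)

/-- The index-two sublattice `M₂(L) = {x ∈ L | β x x is an even integer}` (as a set). -/
def M2set {h : ℕ} (β : (Fin h → ℚ) →ₗ[ℚ] (Fin h → ℚ) →ₗ[ℚ] ℚ)
    (L : Submodule ℤ (Fin h → ℚ)) : Set (Fin h → ℚ) :=
  {x | x ∈ L ∧ ∃ n : ℤ, Even n ∧ β x x = (n : ℚ)}


section GaussSum
open Complex Filter Topology HurwitzZeta

lemma theta_fe {τ : ℂ} (h : τ ≠ 0) :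
    jacobiTheta (-1 / τ) = (-I * τ) ^ (1 / 2 : ℂ) * jacobiTheta τ := by
  have h1 : (-I * τ) ^ (1 / 2 : ℂ) ≠ 0 := by
    rw [Ne, cpow_eq_zero_iff, not_and_or]
    exact Or.inl <| mul_ne_zero (neg_ne_zero.mpr I_ne_zero) h
  have := jacobiTheta₂_functional_equation 0 τ
  rw [jacobiTheta_eq_jacobiTheta₂, jacobiTheta_eq_jacobiTheta₂, this]
  simp at h1 ⊢
  field_simp

lemma theta_sub_nat (τ : ℂ) (m : ℕ) : jacobiTheta (τ - (m + m : ℕ)) = jacobiTheta τ := by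
  induction m with
  | zero => simp
  | succ m ih =>
    rw [← ih, ← jacobiTheta_two_add]
    congr 1; push_cast; ring

lemma theta_split (N : ℕ) (hN : 0 < N) (hev : Even N) (ε : ℝ) (hε : 0 < ε) :
    jacobiTheta (1 / N + I * ε) = ∑ k : Fin N, cexp (Real.pi * I * (k : ℂ) ^ 2 / N) *
      (evenKernel (((k : ℝ) / N : ℝ) : UnitAddCircle) ((N : ℝ) ^ 2 * ε) : ℂ) := by
  have : NeZero N := ⟨hN.ne'⟩
  have hNC : (N : ℂ) ≠ 0 := by exact_mod_cast hN.ne'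
  have hNR : (N : ℝ) ≠ 0 := by exact_mod_cast hN.ne'
  have him : 0 < (1 / (N : ℂ) + I * ε).im := by
    have : (1 / (N : ℂ) + I * ε).im = ε := by
      rw [show (1 / (N : ℂ)) = ((1 / N : ℝ) : ℂ) by push_cast; rfl]
      simp only [add_im, ofReal_im, mul_im, I_re, I_im, ofReal_re]; ring
    rw [this]; exact hε
  have hs := hasSum_jacobiTheta₂_term 0 him
  rw [← jacobiTheta_eq_jacobiTheta₂] at hs
  rw [← (Int.divModEquiv N).symm.hasSum_iff] at hs
  have hs2 := hs.summable
  rw [← hs.tsum_eq]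
  rw [← (Equiv.prodComm _ _).tsum_eq, Summable.tsum_prod, tsum_fintype]
  swap
  · exact (Equiv.summable_iff (Equiv.prodComm _ _)).mpr hs2
  refine Finset.sum_congr rfl fun k _ => ?_
  have hk := hasSum_int_evenKernel ((k : ℝ) / N) (t := (N : ℝ) ^ 2 * ε) (by positivity)
  rw [← Complex.hasSum_ofReal] at hk
  rw [← (hk.mul_left (cexp (Real.pi * I * (k : ℂ) ^ 2 / N))).tsum_eq]
  refine tsum_congr fun m => ?_
  obtain ⟨a, ha⟩ := hev
  simp only [Function.comp, Equiv.prodComm_apply, Prod.swap, Int.divModEquiv, Equiv.coe_fn_symm_mk,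
    jacobiTheta₂_term]
  push_cast
  rw [← Complex.exp_add]
  rw [Complex.exp_eq_exp_iff_exists_int]
  refine ⟨a * m ^ 2 + m * k, ?_⟩
  have haC : (N : ℂ) = a + a := by exact_mod_cast ha
  have : (a : ℂ) = N / 2 := by rw [haC]; ring
  push_cast
  rw [this]
  field_simp
  ring_nf
  simp only [I_sq]
  ring

lemma cos_tendsto (a : UnitAddCircle) : Tendsto (fun t => cosKernel a t) atTop (𝓝 1) := by
  obtain ⟨p, hp, h⟩ := isBigO_atTop_cosKernel_sub a
  have h0 : Tendsto (fun x : ℝ => Real.exp (-p * x)) atTop (𝓝 0) := by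
    refine Real.tendsto_exp_atBot.comp ?_
    exact tendsto_id.const_mul_atTop_of_neg (by linarith)
  have := h.trans_tendsto h0
  simpa using this.add_const 1

lemma theta_eq (N : ℕ) (hN : 0 < N) (hev : Even N) (t : ℝ) (ht : 0 < t) :
    jacobiTheta (1 / N + I * ((1 / ((N:ℝ) ^ 2 * t) : ℝ) : ℂ)) =
      ((N : ℂ) ^ 2 * t / (1 - I * N * t)) ^ (1 / 2 : ℂ) *
      (((t : ℂ) ^ (1 / 2 : ℂ) * (1 + I / (N * t)) ^ (1 / 2 : ℂ)) * jacobiTheta (-1 / N + I * t)) := by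
  have hNC : (N : ℂ) ≠ 0 := by exact_mod_cast hN.ne'
  have htC : (t : ℂ) ≠ 0 := by exact_mod_cast ht.ne'
  have h1 : (1 - I * N * t : ℂ) ≠ 0 := by
    intro h
    have := congrArg re h
    simp at this
  set σ : ℂ := -1 / N + I * t with hσ
  have hσ0 : σ = - (1 - I * N * t) / N := by rw [hσ]; field_simp; ring
  have hσne : σ ≠ 0 := by
    rw [hσ0]; exact div_ne_zero (neg_ne_zero.mpr h1) hNC
  have e1 := theta_fe hσne
  have hz : -1 / σ = N / (1 - I * N * t) := by
    rw [hσ0]; field_simp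
  obtain ⟨a, ha⟩ := hev
  have e2 : jacobiTheta (-1 / σ - N) = jacobiTheta (-1 / σ) := by
    conv_lhs => rw [ha]
    exact theta_sub_nat _ a
  have hy : -1 / σ - N = I * N ^ 2 * t / (1 - I * N * t) := by
    rw [hz, eq_div_iff h1, sub_mul, div_mul_cancel₀ _ h1]; ring
  have hyne : -1 / σ - N ≠ 0 := by
    rw [hy]; refine div_ne_zero ?_ h1
    simp [hNC, htC]
  have e3 := theta_fe hyne
  have e4 : -1 / (-1 / σ - N) = 1 / N + I * ((1 / ((N:ℝ) ^ 2 * t) : ℝ) : ℂ) := by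
    rw [hy]; push_cast; field_simp
    ring_nf; simp only [I_sq]; ring
  have e5 : -I * (-1 / σ - N) = (N : ℂ) ^ 2 * t / (1 - I * N * t) := by
    rw [hy]; field_simp; simp only [I_sq]; ring
  have e6 : -I * σ = t * (1 + I / (N * t)) := by
    rw [hσ]; field_simp; ring_nf; simp only [I_sq]; ring
  rw [e4, e5, e2, e1, e6] at e3
  rw [e3]
  congr 2
  have hne : (1 + I / (N * t) : ℂ) ≠ 0 := by
    intro h
    have : -I * σ = 0 := by rw [e6, h, mul_zero]
    simp [hσne] at this
  rw [cpow_def_of_ne_zero (mul_ne_zero htC hne), cpow_def_of_ne_zero htC, cpow_def_of_ne_zero hne,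
    Complex.log_ofReal_mul ht hne, add_mul, Complex.exp_add, ofReal_log ht.le]

theorem gauss_fin (N : ℕ) (hN : 0 < N) (hev : Even N) :
    ∃ r : ℝ, 0 < r ∧ ∑ k : Fin N, cexp (Real.pi * I * (k : ℂ) ^ 2 / N) =
      r * cexp (Real.pi * I / 4) := by
  have hNC : (N : ℂ) ≠ 0 := by exact_mod_cast hN.ne'
  have hNR : (0 : ℝ) < N := by exact_mod_cast hN
  refine ⟨Real.exp (Real.log N / 2), Real.exp_pos _, ?_⟩
  have lim1 : Tendsto (fun t : ℝ => ∑ k : Fin N, cexp (Real.pi * I * (k : ℂ) ^ 2 / N) *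
      (cosKernel (((k : ℝ) / N : ℝ) : UnitAddCircle) t : ℂ)) atTop
      (𝓝 (∑ k : Fin N, cexp (Real.pi * I * (k : ℂ) ^ 2 / N))) := by
    refine tendsto_finsetSum _ fun k _ => ?_
    have := ((continuous_ofReal.tendsto _).comp (cos_tendsto (((k : ℝ) / N : ℝ) : UnitAddCircle)))
    simpa using this.const_mul (cexp (Real.pi * I * (k : ℂ) ^ 2 / N))
  have hinv : Tendsto (fun t : ℝ => ((t⁻¹ : ℝ) : ℂ)) atTop (𝓝 0) := by
    have := (continuous_ofReal.tendsto 0).comp tendsto_inv_atTop_zero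
    simpa [Function.comp_def] using this
  have l1 : Tendsto (fun t : ℝ => ((N : ℂ) ^ 2 * t / (1 - I * N * t)) ^ (1 / 2 : ℂ)) atTop
      (𝓝 ((N * I) ^ (1 / 2 : ℂ))) := by
    refine Tendsto.cpow ?_ tendsto_const_nhds ?_
    · have : Tendsto (fun t : ℝ => (N : ℂ) ^ 2 / (((t⁻¹ : ℝ) : ℂ) - I * N)) atTop
          (𝓝 ((N : ℂ) ^ 2 / (0 - I * N))) := by
        refine Tendsto.div tendsto_const_nhds (hinv.sub tendsto_const_nhds) ?_
        simp [hNC]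
      have e : (N : ℂ) ^ 2 / (0 - I * N) = N * I := by
        rw [zero_sub]
        have : (-(I * N) : ℂ) ≠ 0 := by simp [hNC]
        field_simp
        simp
      rw [e] at this
      refine this.congr' ?_
      filter_upwards [eventually_gt_atTop 0] with t ht
      have htC : (t : ℂ) ≠ 0 := by exact_mod_cast ht.ne'
      rw [show (1 - I * N * t : ℂ) = (((t⁻¹ : ℝ) : ℂ) - I * N) * t by push_cast; field_simp,
        mul_div_mul_right _ _ htC]
    · right; simp; exact hN.ne'
  have l2 : Tendsto (fun t : ℝ => (1 + I / (N * t)) ^ (1 / 2 : ℂ)) atTop (𝓝 1) := by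
    have : Tendsto (fun t : ℝ => (1 + I / N * ((t⁻¹ : ℝ) : ℂ)) ^ (1 / 2 : ℂ)) atTop
        (𝓝 ((1 + I / N * 0) ^ (1 / 2 : ℂ))) := by
      refine Tendsto.cpow (tendsto_const_nhds.add (hinv.const_mul _)) tendsto_const_nhds ?_
      simp
    simp only [mul_zero, add_zero, one_cpow] at this
    refine this.congr fun t => ?_
    congr 2
    push_cast
    rw [← div_eq_mul_inv, div_div]
  have l3 : Tendsto (fun t : ℝ => jacobiTheta (-1 / N + I * t)) atTop (𝓝 1) := by
    have him : ∀ t : ℝ, (-1 / (N : ℂ) + I * t).im = t := by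
      intro t
      rw [show (-1 / (N : ℂ)) = ((-1 / N : ℝ) : ℂ) by push_cast; rfl]
      simp only [add_im, ofReal_im, mul_im, I_re, I_im, ofReal_re]; ring
    have hc : Tendsto (fun t : ℝ => -1 / (N : ℂ) + I * t) atTop (comap im atTop) := by
      rw [tendsto_comap_iff]
      refine tendsto_id.congr fun t => ?_
      simp only [Function.comp]
      exact (him t).symm
    have := isBigO_at_im_infty_jacobiTheta_sub_one.comp_tendsto hc
    have h0 : Tendsto (fun x : ℝ => Real.exp (-Real.pi * x)) atTop (𝓝 0) := by
      refine Real.tendsto_exp_atBot.comp ?_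
      exact tendsto_id.const_mul_atTop_of_neg (by linarith [Real.pi_pos])
    have h2 := this.trans_tendsto (h0.congr fun t => by simp only [Function.comp, him])
    simpa [Function.comp] using h2.add_const 1
  have lim2 := l1.mul (l2.mul l3)
  have key : ∀ᶠ t : ℝ in atTop, ((N : ℂ) ^ 2 * t / (1 - I * N * t)) ^ (1 / 2 : ℂ) *
      ((1 + I / (N * t)) ^ (1 / 2 : ℂ) * jacobiTheta (-1 / N + I * t)) =
      ∑ k : Fin N, cexp (Real.pi * I * (k : ℂ) ^ 2 / N) *
      (cosKernel (((k : ℝ) / N : ℝ) : UnitAddCircle) t : ℂ) := by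
    filter_upwards [eventually_gt_atTop 0] with t ht
    have hs := theta_split N hN hev (1 / ((N:ℝ) ^ 2 * t)) (by positivity)
    rw [theta_eq N hN hev t ht] at hs
    have e1 : (N : ℝ) ^ 2 * (1 / ((N:ℝ) ^ 2 * t)) = 1 / t := by field_simp
    simp only [e1, evenKernel_functional_equation _ (1 / t), one_div_one_div] at hs
    have e2 : ((1 / (1 / t) ^ (1 / 2 : ℝ) : ℝ) : ℂ) = (t : ℂ) ^ (1 / 2 : ℂ) := by
      rw [one_div t, Real.inv_rpow ht.le, one_div, inv_inv, ofReal_cpow ht.le]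
      push_cast; rfl
    have hne : (t : ℂ) ^ (1 / 2 : ℂ) ≠ 0 := by
      rw [Ne, cpow_eq_zero_iff, not_and_or]
      exact Or.inl (by exact_mod_cast ht.ne')
    simp only [ofReal_mul, e2] at hs
    apply mul_left_cancel₀ hne
    rw [Finset.mul_sum]
    calc _ = _ := by ring
      _ = _ := hs
      _ = _ := Finset.sum_congr rfl fun k _ => by ring
  have := tendsto_nhds_unique lim1 (lim2.congr' key)
  rw [this, mul_one, mul_one]
  have hne : (N * I : ℂ) ≠ 0 := by simp [hNC]
  rw [cpow_def_of_ne_zero hne, show (N : ℂ) = ((N : ℝ) : ℂ) by simp,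
    Complex.log_ofReal_mul hNR I_ne_zero, log_I, add_mul, Complex.exp_add]
  push_cast
  congr 2 <;> ring
end GaussSum

section Lattice
open Complex

lemma avg_lemma {A : Type*} [AddCommGroup A] [Fintype A] (F : A → ℂ) (hF : ∀ x, F x ≠ 0)
    (H : AddSubgroup A)
    (hm : ∀ x, ∀ y ∈ H, ∀ y' ∈ H, F (x + y + y') * F x = F (x + y) * F (x + y')) :
    open Classical in
    ∑ x, F x = ∑ x with (∀ y ∈ H, F (x + y) = F x), F x := by
  classical
  have h1 : ∀ y : A, ∑ x, F (x + y) = ∑ x, F x := fun y =>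
    Equiv.sum_comp (Equiv.addRight y) F
  have hc : ((Fintype.card H : ℕ) : ℂ) ≠ 0 := by
    exact_mod_cast Fintype.card_ne_zero
  apply mul_left_cancel₀ hc
  have h2 : (Fintype.card H : ℂ) * ∑ x, F x = ∑ x, ∑ y : H, F (x + y) := by
    rw [Finset.sum_comm]
    simp [h1]
  rw [h2, Finset.sum_filter, Finset.mul_sum]
  refine Finset.sum_congr rfl fun x _ => ?_
  split_ifs with hx
  · rw [Finset.sum_congr rfl (fun (y : H) _ => hx y y.2)]
    simp
  · push Not at hx
    obtain ⟨y0, hy0, hne⟩ := hx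
    rw [mul_zero]
    have e1 : ∑ y : H, F (x + y) = ∑ y : H, F (x + y + y0) := by
      rw [← Equiv.sum_comp (Equiv.addRight (⟨y0, hy0⟩ : H)) (fun y : H => F (x + y))]
      refine Finset.sum_congr rfl fun y _ => ?_
      simp [add_assoc]
    have e2 : (∑ y : H, F (x + y)) * F x = (∑ y : H, F (x + y)) * F (x + y0) := by
      conv_lhs => rw [e1]
      rw [Finset.sum_mul, Finset.sum_mul]
      exact Finset.sum_congr rfl fun y _ => hm x y y.2 y0 hy0
    by_contra h0
    exact hne (mul_left_cancel₀ h0 e2).symm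

/-- the additive character `q ↦ exp (2 π i q)` -/
noncomputable def eQ (q : ℚ) : ℂ := cexp (2 * Real.pi * I * q)

lemma eQ_add (p q : ℚ) : eQ (p + q) = eQ p * eQ q := by
  simp only [eQ, ← Complex.exp_add]; push_cast; ring_nf

lemma eQ_ne (q : ℚ) : eQ q ≠ 0 := Complex.exp_ne_zero _

lemma eQ_norm (q : ℚ) : ‖eQ q‖ = 1 := by
  have := Complex.norm_exp_ofReal_mul_I (2 * Real.pi * q)
  rw [← this, eQ]; congr 2; push_cast; ring

lemma eQ_one_iff (q : ℚ) : eQ q = 1 ↔ ∃ n : ℤ, q = n := by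
  rw [eQ, Complex.exp_eq_one_iff]
  have h2 := Complex.two_pi_I_ne_zero
  constructor
  · rintro ⟨n, hn⟩
    refine ⟨n, ?_⟩
    rw [mul_comm] at hn
    exact_mod_cast mul_right_cancel₀ h2 hn
  · rintro ⟨n, rfl⟩
    exact ⟨n, by push_cast; ring⟩

lemma eQ_int (n : ℤ) : eQ n = 1 := (eQ_one_iff _).2 ⟨n, rfl⟩

lemma eQ_sum {ι : Type*} (s : Finset ι) (f : ι → ℚ) : eQ (∑ i ∈ s, f i) = ∏ i ∈ s, eQ (f i) := by
  classical
  induction s using Finset.induction with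
  | empty => simp [eQ]
  | insert a s ha ih => rw [Finset.sum_insert ha, Finset.prod_insert ha, eQ_add, ih]

lemma gauss_zmod (N : ℕ) [NeZero N] (hN : 0 < N) (hev : Even N) :
    ∃ r : ℝ, 0 < r ∧ ∑ k : ZMod N, eQ ((k.val : ℚ) ^ 2 / N / 2) =
      r * cexp (Real.pi * I / 4) := by
  obtain ⟨r, hr, h⟩ := gauss_fin N hN hev
  refine ⟨r, hr, ?_⟩
  rw [← h]
  obtain ⟨m, rfl⟩ : ∃ m, N = m + 1 := ⟨N - 1, by omega⟩
  change ∑ k : Fin (m + 1), eQ (((k : ℕ) : ℚ) ^ 2 / (m + 1 : ℕ) / 2) = _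
  refine Finset.sum_congr rfl fun k _ => ?_
  rw [eQ]; congr 1; push_cast; ring

lemma eQ_val (N : ℕ) (hN : 0 < N) (hev : Even N) (k : ℤ) :
    eQ ((((k : ZMod N).val : ℕ) : ℚ) ^ 2 / N / 2) = eQ ((k : ℚ) ^ 2 / N / 2) := by
  have : NeZero N := ⟨hN.ne'⟩
  obtain ⟨a, ha⟩ := hev
  set v := (k : ZMod N).val with hv
  obtain ⟨c, hc⟩ : ∃ c : ℤ, k = v + N * c := by
    have : (((v : ℕ) : ℤ) : ZMod N) = (k : ZMod N) := by
      rw [hv]; simp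
    rw [ZMod.intCast_eq_intCast_iff_dvd_sub] at this
    obtain ⟨c, hc⟩ := this
    exact ⟨c, by linarith⟩
  have hNQ : (N : ℚ) ≠ 0 := by exact_mod_cast hN.ne'
  have haQ : (N : ℚ) = a + a := by exact_mod_cast ha
  have : (k : ℚ) ^ 2 / N / 2 = (v : ℚ) ^ 2 / N / 2 + ((v * c + a * c ^ 2 : ℤ) : ℚ) := by
    rw [hc]; push_cast
    have : (a : ℚ) = N / 2 := by rw [haQ]; ring
    rw [this]
    field_simp; ring
  rw [this, eQ_add, eQ_int, mul_one]

/-- Van der Blij type statement from an orthogonal frame. -/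
theorem key_of_frame {h : ℕ} (h0 : h % 8 = 0)
    (β : (Fin h → ℚ) →ₗ[ℚ] (Fin h → ℚ) →ₗ[ℚ] ℚ)
    (hsymm : ∀ x y, β x y = β y x)
    (L : Submodule ℤ (Fin h → ℚ)) (hL : IsUnimodularLattice β L)
    (e : Fin h → Fin h → ℚ) (heL : ∀ i, e i ∈ L) (N : Fin h → ℕ) (hN : ∀ i, 0 < N i)
    (hev : ∀ i, Even (N i)) (hee : ∀ i, β (e i) (e i) = N i)
    (horth : ∀ i j, i ≠ j → β (e i) (e j) = 0)
    (hexp : ∀ v, v = ∑ i, (β v (e i) / N i) • e i) :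
    ∃ v, (∀ y ∈ L, ∃ n : ℤ, β v y + β y y / 2 = n) ∧ ∃ n : ℤ, β v v / 2 = n := by
  classical
  have : ∀ i, NeZero (N i) := fun i => ⟨(hN i).ne'⟩
  have hNQ : ∀ i, (N i : ℚ) ≠ 0 := fun i => by exact_mod_cast (hN i).ne'
  let X : (Fin h → ℤ) →+ (Fin h → ℚ) :=
    { toFun := fun k => ∑ i, ((k i : ℚ) / N i) • e i
      map_zero' := by simp
      map_add' := fun k l => by
        rw [← Finset.sum_add_distrib]
        refine Finset.sum_congr rfl fun i _ => ?_
        rw [← add_smul]; congr 1; simp only [Pi.add_apply]; push_cast; ring }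
  have hX : ∀ k, X k = ∑ i, ((k i : ℚ) / N i) • e i := fun k => rfl
  have hXX : ∀ k l, β (X k) (X l) = ∑ i, (k i : ℚ) * l i / N i := by
    intro k l
    rw [hX k, map_sum, LinearMap.sum_apply]
    refine Finset.sum_congr rfl fun i _ => ?_
    rw [hX l, map_sum, Finset.sum_eq_single i]
    · simp only [map_smul, LinearMap.smul_apply, hee, smul_eq_mul]
      have := hNQ i
      field_simp
    · intro j _ hj
      simp [horth i j hj.symm]
    · simp
  let P : (Fin h → ℤ) →+ (∀ i, ZMod (N i)) :=
    { toFun := fun k i => (k i : ZMod (N i))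
      map_zero' := by ext i; simp
      map_add' := fun k l => by ext i; simp }
  have hP : ∀ k i, P k i = (k i : ZMod (N i)) := fun k i => rfl
  have hPs : ∀ c, ∃ k, P k = c := by
    intro c
    refine ⟨fun i => ((c i).val : ℤ), ?_⟩
    ext i
    rw [hP]; simp
  let F : (∀ i, ZMod (N i)) → ℂ := fun c => ∏ i, eQ (((c i).val : ℚ) ^ 2 / N i / 2)
  have hF : ∀ k, F (P k) = eQ (β (X k) (X k) / 2) := by
    intro k
    rw [hXX, Finset.sum_div, eQ_sum]
    refine Finset.prod_congr rfl fun i _ => ?_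
    rw [hP, eQ_val _ (hN i) (hev i)]
    congr 3; ring
  have hFne : ∀ c, F c ≠ 0 := by
    intro c; obtain ⟨k, rfl⟩ := hPs c; rw [hF]; exact eQ_ne _
  have hlift : ∀ y ∈ L, ∃ k, X k = y := by
    intro y hy
    choose n hn using fun i => (hL y).1 hy (e i) (heL i)
    refine ⟨n, ?_⟩
    rw [hX]; conv_rhs => rw [hexp y]
    simp [hn]
  let H : AddSubgroup (∀ i, ZMod (N i)) := (L.toAddSubgroup.comap X).map P
  have hH : ∀ c, c ∈ H ↔ ∃ k, X k ∈ L ∧ P k = c := by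
    intro c; simp [H, AddSubgroup.mem_map]
  have hm : ∀ x, ∀ y ∈ H, ∀ y' ∈ H, F (x + y + y') * F x = F (x + y) * F (x + y') := by
    intro x y hy y' hy'
    obtain ⟨k, rfl⟩ := hPs x
    obtain ⟨l, hl, rfl⟩ := (hH y).1 hy
    obtain ⟨l', hl', rfl⟩ := (hH y').1 hy'
    simp only [← map_add, hF, ← eQ_add]
    obtain ⟨n, hn⟩ := (hL _).1 hl _ hl'
    have hn' := hn
    rw [hsymm] at hn'
    have : β (X (k + l + l')) (X (k + l + l')) / 2 + β (X k) (X k) / 2 =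
      β (X (k + l)) (X (k + l)) / 2 + β (X (k + l')) (X (k + l')) / 2 + (n : ℚ) := by
      simp only [map_add, LinearMap.add_apply, hn, hn']
      ring
    rw [this, eQ_add, eQ_int, mul_one]
  have hav := avg_lemma F hFne H hm
  obtain ⟨R, hR, hS⟩ : ∃ R : ℝ, 0 < R ∧ ∑ c, F c = R := by
    choose r hr hg using fun i => gauss_zmod (N i) (hN i) (hev i)
    refine ⟨∏ i, r i, Finset.prod_pos fun i _ => hr i, ?_⟩
    have := Fintype.prod_sum (fun i (c : ZMod (N i)) => eQ ((c.val : ℚ) ^ 2 / N i / 2))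
    rw [← this, Finset.prod_congr rfl (fun i _ => hg i), Finset.prod_mul_distrib]
    have h8 : ∏ _i : Fin h, cexp (Real.pi * I / 4) = 1 := by
      rw [Finset.prod_const, Finset.card_univ, Fintype.card_fin, ← Complex.exp_nat_mul,
        Complex.exp_eq_one_iff]
      obtain ⟨q, hq⟩ : ∃ q : ℕ, h = 8 * q := ⟨h / 8, by omega⟩
      have hqC : (h : ℂ) = 8 * q := by exact_mod_cast hq
      refine ⟨q, ?_⟩
      rw [hqC]
      push_cast; ring
    rw [h8]; push_cast; ring
  rw [hS] at hav
  -- elements of the invariant set are characteristic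
  have hQ : ∀ k, (∀ y ∈ H, F (P k + y) = F (P k)) →
      ∀ y ∈ L, ∃ n : ℤ, β (X k) y + β y y / 2 = n := by
    intro k hk y hy
    obtain ⟨l, rfl⟩ := hlift y hy
    have := hk (P l) ((hH _).2 ⟨l, hy, rfl⟩)
    rw [← map_add, hF, hF] at this
    rw [← eQ_one_iff]
    have e1 : β (X (k + l)) (X (k + l)) / 2 =
      β (X k) (X k) / 2 + (β (X k) (X l) + β (X l) (X l) / 2) := by
      simp only [map_add, LinearMap.add_apply, hsymm (X l) (X k)]; ring
    rw [e1, eQ_add] at this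
    exact mul_left_cancel₀ (eQ_ne _) (this.trans (mul_one _).symm)
  set Q := Finset.univ.filter (fun c => ∀ y ∈ H, F (c + y) = F c) with hQdef
  have hQne : Q.Nonempty := by
    rw [Finset.nonempty_iff_ne_empty]
    intro hemp
    rw [hemp, Finset.sum_empty] at hav
    exact hR.ne' (by exact_mod_cast hav)
  obtain ⟨c0, hc0⟩ := hQne
  obtain ⟨k0, rfl⟩ := hPs c0
  have hk0 := hQ k0 (Finset.mem_filter.1 hc0).2
  refine ⟨X k0, hk0, ?_⟩
  have hconst : ∀ c ∈ Q, F c = F (P k0) := by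
    intro c hc
    obtain ⟨k, rfl⟩ := hPs c
    have hk := hQ k (Finset.mem_filter.1 hc).2
    have hd : X (k - k0) ∈ L := by
      rw [hL]; intro y hy
      obtain ⟨n, hn⟩ := hk y hy
      obtain ⟨m, hm⟩ := hk0 y hy
      refine ⟨n - m, ?_⟩
      rw [map_sub, map_sub, LinearMap.sub_apply]; push_cast; linarith
    have := (Finset.mem_filter.1 hc0).2 (P (k - k0)) ((hH _).2 ⟨_, hd, rfl⟩)
    rw [← map_add] at this
    simpa using this
  rw [Finset.sum_congr rfl hconst, Finset.sum_const, nsmul_eq_mul] at hav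
  rw [← eQ_one_iff, ← hF]
  have hnorm : ‖F (P k0)‖ = 1 := by rw [hF]; exact eQ_norm _
  have hcard : R = (Q.card : ℝ) := by
    have := congrArg norm hav
    rw [norm_mul, hnorm, mul_one] at this
    simpa [abs_of_pos hR] using this
  have hcne : ((Q.card : ℕ) : ℂ) ≠ 0 := by
    have : (Q.card : ℝ) ≠ 0 := by rw [← hcard]; exact hR.ne'
    exact_mod_cast this
  rw [hcard] at hav
  apply mul_left_cancel₀ hcne
  rw [mul_one]; rw [← hav]; simp

theorem exists_mul_mem {h : ℕ} (β : (Fin h → ℚ) →ₗ[ℚ] (Fin h → ℚ) →ₗ[ℚ] ℚ)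
    (hpos : ∀ x, x ≠ 0 → 0 < β x x)
    (L : Submodule ℤ (Fin h → ℚ)) (hL : IsUnimodularLattice β L) (v : Fin h → ℚ) :
    ∃ n : ℤ, n ≠ 0 ∧ n • v ∈ L := by
  let W : Submodule ℚ (Fin h → ℚ) :=
    { carrier := {v | ∃ n : ℤ, n ≠ 0 ∧ n • v ∈ L}
      zero_mem' := ⟨1, one_ne_zero, by simp⟩
      add_mem' := by
        rintro a b ⟨n, hn, hna⟩ ⟨m, hm, hmb⟩
        refine ⟨n * m, mul_ne_zero hn hm, ?_⟩
        rw [smul_add]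
        refine L.add_mem ?_ ?_
        · rw [mul_comm, mul_smul]; exact L.smul_mem _ hna
        · rw [mul_smul]; exact L.smul_mem _ hmb
      smul_mem' := by
        rintro q a ⟨n, hn, hna⟩
        refine ⟨q.den * n, mul_ne_zero (by exact_mod_cast q.den_ne_zero) hn, ?_⟩
        have : ((q.den * n : ℤ)) • (q • a) = q.num • (n • a) := by
          rw [← Int.cast_smul_eq_zsmul ℚ, ← Int.cast_smul_eq_zsmul ℚ, ← Int.cast_smul_eq_zsmul ℚ,
            smul_smul, smul_smul]
          congr 1
          have := Rat.mul_den_eq_num q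
          push_cast
          rw [← this]; ring
        rw [this]; exact L.smul_mem _ hna }
  suffices hW : W = ⊤ by
    have : v ∈ W := by rw [hW]; trivial
    exact this
  by_contra hne
  obtain ⟨f, hf, hfW⟩ := Submodule.exists_le_ker_of_lt_top W (lt_top_iff_ne_top.2 hne)
  have hinj : Function.Injective β := by
    rw [injective_iff_map_eq_zero]
    intro x hx
    by_contra hx0
    have := hpos x hx0
    rw [hx] at this; simp at this
  have hsurj : Function.Surjective β := by
    refine (LinearMap.injective_iff_surjective_of_finrank_eq_finrank ?_).1 hinj
    exact Subspace.dual_finrank_eq.symm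
  obtain ⟨w, rfl⟩ := hsurj f
  have hw0 : w ≠ 0 := by rintro rfl; exact hf (map_zero _)
  have hLW : ∀ x ∈ L, x ∈ W := fun x hx => ⟨1, one_ne_zero, by simpa using hx⟩
  have hwL : w ∈ L := by
    rw [hL]; intro x hx
    refine ⟨0, ?_⟩
    have := hfW (hLW x hx)
    simpa using this
  have := hfW (hLW w hwL)
  exact (hpos w hw0).ne' this

theorem key {h : ℕ} (h0 : h % 8 = 0)
    (β : (Fin h → ℚ) →ₗ[ℚ] (Fin h → ℚ) →ₗ[ℚ] ℚ)
    (hsymm : ∀ x y, β x y = β y x)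
    (hpos : ∀ x, x ≠ 0 → 0 < β x x)
    (L : Submodule ℤ (Fin h → ℚ)) (hL : IsUnimodularLattice β L) :
    ∃ v, (∀ y ∈ L, ∃ n : ℤ, β v y + β y y / 2 = n) ∧ ∃ n : ℤ, β v v / 2 = n := by
  have : Invertible (2 : ℚ) := invertibleOfNonzero two_ne_zero
  obtain ⟨b', hb'⟩ := LinearMap.BilinForm.exists_orthogonal_basis (B := β) ⟨hsymm⟩
  let b := b'.reindex (finCongr (Module.finrank_fin_fun ℚ (n := h)))
  have hb : ∀ i j, i ≠ j → β (b i) (b j) = 0 := by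
    intro i j hij
    simp only [b, Module.Basis.reindex_apply]
    exact hb' (fun h => hij ((finCongr _).symm.injective h))
  have hbb : ∀ i, β (b i) (b i) ≠ 0 := fun i => (hpos _ (b.ne_zero i)).ne'
  choose n hn hnL using fun i => exists_mul_mem β hpos L hL (b i)
  choose m hm using fun i => (hL _).1 (hnL i) _ (hnL i)
  have hm' : ∀ i, (n i : ℚ) * (n i * β (b i) (b i)) = m i := by
    intro i
    have := hm i
    simpa [← Int.cast_smul_eq_zsmul ℚ] using this
  have hnQ : ∀ i, (n i : ℚ) ≠ 0 := fun i => by exact_mod_cast hn i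
  have hmpos : ∀ i, 0 < m i := by
    intro i
    have h1 := hpos _ (b.ne_zero i)
    have h2 : (0 : ℚ) < m i := by
      rw [← hm' i, ← mul_assoc]
      exact mul_pos (mul_self_pos.2 (hnQ i)) h1
    exact_mod_cast h2
  have hN : ∀ i, (((4 * m i).toNat : ℕ) : ℚ) = 4 * m i := by
    intro i
    have : (((4 * m i).toNat : ℕ) : ℤ) = 4 * m i := Int.toNat_of_nonneg (by linarith [hmpos i])
    exact_mod_cast this
  refine key_of_frame h0 β hsymm L hL (fun i => (2 * n i : ℚ) • b i) ?_ (fun i => (4 * m i).toNat)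
    ?_ ?_ ?_ ?_ ?_
  · intro i
    have := L.smul_mem 2 (hnL i)
    rw [smul_smul, ← Int.cast_smul_eq_zsmul ℚ] at this
    simpa using this
  · intro i; have := hmpos i; omega
  · intro i; have := hmpos i; exact ⟨2 * (m i).toNat, by omega⟩
  · intro i
    rw [hN, ← hm' i]
    simp only [map_smul, LinearMap.smul_apply, smul_eq_mul]; ring
  · intro i j hij
    simp [hb i j hij]
  · intro v
    conv_lhs => rw [← b.sum_repr v]
    refine Finset.sum_congr rfl fun i _ => ?_
    have h1 : β v (b i) = b.repr v i * β (b i) (b i) := by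
      conv_lhs => rw [← b.sum_repr v]
      rw [map_sum, LinearMap.sum_apply, Finset.sum_eq_single i]
      · simp
      · intro j _ hj; simp [hb j i hj]
      · simp
    rw [hN, ← hm' i, smul_smul]
    congr 1
    simp only [map_smul, smul_eq_mul, h1]
    have := hnQ i
    have := hbb i
    field_simp
    ring

/-- being an integer -/
def IsI (q : ℚ) : Prop := ∃ n : ℤ, q = n

lemma IsI.add {p q : ℚ} (hp : IsI p) (hq : IsI q) : IsI (p + q) := by
  obtain ⟨a, rfl⟩ := hp; obtain ⟨b, rfl⟩ := hq; exact ⟨a + b, by push_cast; rfl⟩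

lemma IsI.sub {p q : ℚ} (hp : IsI p) (hq : IsI q) : IsI (p - q) := by
  obtain ⟨a, rfl⟩ := hp; obtain ⟨b, rfl⟩ := hq; exact ⟨a - b, by push_cast; rfl⟩

lemma IsI.zmul {p : ℚ} (n : ℤ) (hp : IsI p) : IsI (n * p) := by
  obtain ⟨a, rfl⟩ := hp; exact ⟨n * a, by push_cast; rfl⟩

lemma isI_half {q : ℚ} : (∃ n : ℤ, Even n ∧ q = n) ↔ IsI (q / 2) := by
  constructor
  · rintro ⟨n, ⟨m, rfl⟩, rfl⟩; exact ⟨m, by push_cast; ring⟩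
  · rintro ⟨m, hm⟩; exact ⟨m + m, ⟨m, rfl⟩, by push_cast; linarith⟩

/-- if `p` is a half-integer and neither `p` nor `q` is an integer, but `2p`, `2q` are -/
lemma isI_add_of_not {p q : ℚ} (hp2 : IsI (2 * p)) (hq2 : IsI (2 * q)) (hp : ¬ IsI p)
    (hq : ¬ IsI q) : IsI (p + q) := by
  obtain ⟨a, ha⟩ := hp2
  obtain ⟨b, hb⟩ := hq2
  rcases Int.even_or_odd' a with ⟨c, rfl | rfl⟩
  · exact absurd ⟨c, by push_cast at ha; linarith⟩ hp
  · rcases Int.even_or_odd' b with ⟨d, rfl | rfl⟩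
    · exact absurd ⟨d, by push_cast at hb; linarith⟩ hq
    · exact ⟨c + d + 1, by push_cast at *; linarith⟩

section Final
variable {h : ℕ} (β : (Fin h → ℚ) →ₗ[ℚ] (Fin h → ℚ) →ₗ[ℚ] ℚ)
  (L : Submodule ℤ (Fin h → ℚ))

/-- dual of the even sublattice -/
def DM (u : Fin h → ℚ) : Prop := ∀ x ∈ L, IsI (β x x / 2) → IsI (β u x)

/-- `2v` is characteristic -/
def Chr (v : Fin h → ℚ) : Prop := ∀ y ∈ L, IsI (β v y + β y y / 2)

/-- the neighbour attached to `v` -/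
def Nb (v : Fin h → ℚ) : Submodule ℤ (Fin h → ℚ) where
  carrier := {x | DM β L x ∧ IsI (β x v)}
  zero_mem' := ⟨fun _ _ _ => ⟨0, by simp⟩, ⟨0, by simp⟩⟩
  add_mem' := by
    rintro a b ⟨ha, ha'⟩ ⟨hb, hb'⟩
    refine ⟨fun x hx hx2 => ?_, ?_⟩
    · rw [map_add, LinearMap.add_apply]; exact (ha x hx hx2).add (hb x hx hx2)
    · rw [map_add, LinearMap.add_apply]; exact ha'.add hb'
  smul_mem' := by
    rintro n a ⟨ha, ha'⟩
    refine ⟨fun x hx hx2 => ?_, ?_⟩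
    · rw [← Int.cast_smul_eq_zsmul ℚ, map_smul, LinearMap.smul_apply]
      exact (ha x hx hx2).zmul n
    · rw [← Int.cast_smul_eq_zsmul ℚ, map_smul, LinearMap.smul_apply]
      exact ha'.zmul n

variable {β L}

lemma mem_Nb {v x : Fin h → ℚ} : x ∈ Nb β L v ↔ DM β L x ∧ IsI (β x v) := Iff.rfl

lemma norm_sub (hsymm : ∀ x y, β x y = β y x) (x y : Fin h → ℚ) :
    β (x - y) (x - y) = β x x - 2 * β x y + β y y := by
  simp only [map_sub, LinearMap.sub_apply, hsymm y x]; ring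

lemma sub_even (hsymm : ∀ x y, β x y = β y x) (hL : IsUnimodularLattice β L)
    {y z : Fin h → ℚ} (hy : y ∈ L) (hz : z ∈ L) (hyo : ¬ IsI (β y y / 2))
    (hzo : ¬ IsI (β z z / 2)) : IsI (β (z - y) (z - y) / 2) := by
  have h1 : IsI (β z y) := (hL z).1 hz y hy
  have h2 : IsI (β z z / 2 + β y y / 2) := by
    refine isI_add_of_not ?_ ?_ hzo hyo
    · rw [mul_div_cancel₀ _ two_ne_zero]; exact (hL z).1 hz z hz
    · rw [mul_div_cancel₀ _ two_ne_zero]; exact (hL y).1 hy y hy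
  have := h2.sub h1
  rw [norm_sub hsymm]
  convert this using 1; ring

lemma chr_of_DM (hsymm : ∀ x y, β x y = β y x) (hL : IsUnimodularLattice β L)
    {u : Fin h → ℚ} (hu : DM β L u) (huL : u ∉ L) : Chr β L u := by
  intro y hy
  by_cases hye : IsI (β y y / 2)
  · exact (hu y hy hye).add hye
  have hyy : IsI (β y y) := (hL y).1 hy y hy
  refine isI_add_of_not ?_ ?_ ?_ hye
  · have := hu ((2 : ℤ) • y) (L.smul_mem _ hy) ?_
    · rw [← Int.cast_smul_eq_zsmul ℚ, map_smul] at this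
      simpa using this
    · rw [← Int.cast_smul_eq_zsmul ℚ, map_smul, map_smul]
      convert hyy.zmul 2 using 1
      simp
  · rw [mul_div_cancel₀ _ two_ne_zero]; exact hyy
  · intro huy
    apply huL
    rw [hL]
    intro z hz
    by_cases hze : IsI (β z z / 2)
    · exact hu z hz hze
    have := (hu (z - y) (L.sub_mem hz hy) (sub_even hsymm hL hy hz hye hze)).add huy
    rw [map_sub, sub_add_cancel] at this
    exact this

lemma Chr.sub_mem (hL : IsUnimodularLattice β L) {u v : Fin h → ℚ} (hu : Chr β L u)
    (hv : Chr β L v) : u - v ∈ L := by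
  rw [hL]; intro y hy
  have := (hu y hy).sub (hv y hy)
  rw [map_sub, LinearMap.sub_apply]
  rwa [add_sub_add_right_eq_sub] at this

lemma Chr.even (hsymm : ∀ x y, β x y = β y x) (hL : IsUnimodularLattice β L)
    {u v : Fin h → ℚ} (hu : Chr β L u) (hv : Chr β L v) (hve : IsI (β v v / 2)) :
    IsI (β u u / 2) := by
  have := (hv _ (Chr.sub_mem hL hu hv)).add hve
  rw [norm_sub hsymm] at this
  convert this using 1
  simp only [map_sub, hsymm v u]; ring

lemma Chr.DM {v : Fin h → ℚ} (hv : Chr β L v) : DM β L v := by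
  intro x hx hxe
  have := (hv x hx).sub hxe
  rwa [add_sub_cancel_right] at this

lemma Chr.isI_iff (hsymm : ∀ x y, β x y = β y x) {v x : Fin h → ℚ} (hv : Chr β L v)
    (hx : x ∈ L) : IsI (β x v) ↔ IsI (β x x / 2) := by
  rw [hsymm x v]
  constructor
  · intro h1
    have := (hv x hx).sub h1
    rwa [add_sub_cancel_left] at this
  · exact hv.DM x hx

lemma Nb_unimodular (hsymm : ∀ x y, β x y = β y x) (hL : IsUnimodularLattice β L)
    {v : Fin h → ℚ} (hv : Chr β L v) (hve : IsI (β v v / 2)) :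
    IsUnimodularLattice β (Nb β L v) := by
  have hvv : IsI (β v v) := by
    have := hve.zmul 2
    convert this using 1; push_cast; ring
  intro x
  constructor
  · rintro hx z hz
    by_cases hxL : x ∈ L
    · rw [hsymm x z]
      exact hz.1 x hxL ((hv.isI_iff hsymm hxL).1 hx.2)
    · have hc := chr_of_DM hsymm hL hx.1 hxL
      have hd := Chr.sub_mem hL hc hv
      have h1 : IsI (β (x - v) v) := by
        rw [map_sub, LinearMap.sub_apply]; exact hx.2.sub hvv
      have h2 := (hz.1 _ hd ((hv.isI_iff hsymm hd).1 h1)).add hz.2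
      rw [map_sub, sub_add_cancel, hsymm] at h2
      exact h2
  · intro hx
    refine ⟨fun y hy hye => hx y ⟨?_, ?_⟩, hx v ⟨hv.DM, hvv⟩⟩
    · intro z hz _; exact (hL y).1 hy z hz
    · exact (hv.isI_iff hsymm hy).2 hye

lemma Nb_inter (hsymm : ∀ x y, β x y = β y x) (hL : IsUnimodularLattice β L)
    {v : Fin h → ℚ} (hv : Chr β L v) :
    ((Nb β L v ⊓ L : Submodule ℤ (Fin h → ℚ)) : Set (Fin h → ℚ)) = M2set β L := by
  ext x
  simp only [M2set, Set.mem_setOf_eq, SetLike.mem_coe, Submodule.mem_inf, isI_half, mem_Nb]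
  constructor
  · rintro ⟨⟨_, h2⟩, h3⟩; exact ⟨h3, (hv.isI_iff hsymm h3).1 h2⟩
  · rintro ⟨h1, h2⟩
    exact ⟨⟨fun z hz _ => (hL x).1 h1 z hz, (hv.isI_iff hsymm h1).2 h2⟩, h1⟩

lemma DM_of_mem {N : Submodule ℤ (Fin h → ℚ)} (hN : IsUnimodularLattice β N)
    (hNL : ((N ⊓ L : Submodule ℤ (Fin h → ℚ)) : Set (Fin h → ℚ)) = M2set β L)
    {x : Fin h → ℚ} (hx : x ∈ N) : DM β L x := by
  intro y hy hye
  have : y ∈ M2set β L := ⟨hy, isI_half.2 hye⟩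
  rw [← hNL] at this
  exact (hN x).1 hx y this.1

lemma eq_Nb (hsymm : ∀ x y, β x y = β y x) 
    {N : Submodule ℤ (Fin h → ℚ)} (hN : IsUnimodularLattice β N)
    (hNL : ((N ⊓ L : Submodule ℤ (Fin h → ℚ)) : Set (Fin h → ℚ)) = M2set β L)
    {u v : Fin h → ℚ} (hu : u ∈ N) (hNb : IsUnimodularLattice β (Nb β L v))
    (hd : u - v ∈ L) (hde : IsI (β (u - v) (u - v) / 2)) : N = Nb β L v := by
  have h1 : N ≤ Nb β L v := by
    intro x hx
    have hD := DM_of_mem hN hNL hx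
    refine ⟨hD, ?_⟩
    have h2 : IsI (β x u) := (hN x).1 hx u hu
    have := h2.sub (hD _ hd hde)
    rwa [map_sub, sub_sub_cancel] at this
  refine le_antisymm h1 fun x hx => ?_
  rw [hN]; intro z hz
  exact (hNb x).1 hx z (h1 hz)

end Final

end Lattice

/-- an odd unimodular integral lattice of rank `h ≡ 0 mod 8` has exactly
two neighbours sharing the index-two sublattice `M₂(L)`, and both are even. -/
theorem stmt15 (h : ℕ) (hh : 1 ≤ h) (h0 : h % 8 = 0)
    (β : (Fin h → ℚ) →ₗ[ℚ] (Fin h → ℚ) →ₗ[ℚ] ℚ)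
    (hsymm : ∀ x y, β x y = β y x)
    (hpos : ∀ x, x ≠ 0 → 0 < β x x)
    (L : Submodule ℤ (Fin h → ℚ))
    (hL : IsUnimodularLattice β L) (hodd : IsOddLattice β L) :
    (∃ N₁ N₂ : Submodule ℤ (Fin h → ℚ), N₁ ≠ N₂ ∧
      {N : Submodule ℤ (Fin h → ℚ) | IsUnimodularLattice β N ∧
          ((N ⊓ L : Submodule ℤ (Fin h → ℚ)) : Set (Fin h → ℚ)) = M2set β L}
        = {N₁, N₂}) ∧
    (∀ N : Submodule ℤ (Fin h → ℚ), IsUnimodularLattice β N →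
      ((N ⊓ L : Submodule ℤ (Fin h → ℚ)) : Set (Fin h → ℚ)) = M2set β L →
      IsEvenLattice β N) := by
  have hodd' : ∃ a ∈ L, ¬ IsI (β a a / 2) := by
    obtain ⟨a, ha, n, hn, hna⟩ := hodd
    refine ⟨a, ha, ?_⟩
    rw [← isI_half]
    rintro ⟨m, hm, hma⟩
    have : n = m := by exact_mod_cast hna.symm.trans hma
    subst this
    exact (Int.not_even_iff_odd.2 hn) hm
  obtain ⟨a, ha, hao⟩ := hodd'
  obtain ⟨v, hv, hve⟩ := key h0 β hsymm hpos L hL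
  have hv : Chr β L v := hv
  have hve : IsI (β v v / 2) := hve
  have hall : ∀ u, Chr β L u → IsI (β u u / 2) := fun u hu => Chr.even hsymm hL hu hv hve
  have hva : Chr β L (v + a) := by
    intro y hy
    have h1 : IsI (β a y) := (hL a).1 ha y hy
    have := (hv y hy).add h1
    rw [map_add, LinearMap.add_apply]
    convert this using 1; ring
  have hnot : ∀ u, Chr β L u → u ∉ L := by
    intro u hu huL
    have h1 : IsI (β u a) := (hL u).1 huL a ha
    rw [hsymm] at h1
    exact hao ((hu.isI_iff hsymm ha).1 h1)
  have hU1 := Nb_unimodular hsymm hL hv hve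
  have hU2 := Nb_unimodular hsymm hL hva (hall _ hva)
  refine ⟨⟨Nb β L v, Nb β L (v + a), ?_, ?_⟩, ?_⟩
  · intro heq
    have hvv : IsI (β v v) := by
      have := hve.zmul 2
      convert this using 1; push_cast; ring
    have h1 : v ∈ Nb β L v := ⟨hv.DM, hvv⟩
    rw [heq] at h1
    have h2 := h1.2.sub hvv
    rw [map_add, add_sub_cancel_left, hsymm] at h2
    exact hao ((hv.isI_iff hsymm ha).1 h2)
  · ext N
    simp only [Set.mem_setOf_eq, Set.mem_insert_iff, Set.mem_singleton_iff]
    constructor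
    · rintro ⟨hN, hNL⟩
      obtain ⟨u, huN, huL⟩ : ∃ u ∈ N, u ∉ L := by
        by_contra hcon
        push Not at hcon
        refine hnot v hv (hcon v ?_)
        rw [hN]; intro x hx
        have : x ∈ ((N ⊓ L : Submodule ℤ (Fin h → ℚ)) : Set (Fin h → ℚ)) := ⟨hx, hcon x hx⟩
        rw [hNL] at this
        exact hv.DM x this.1 (isI_half.1 this.2)
      have hu := chr_of_DM hsymm hL (DM_of_mem hN hNL huN) huL
      have hd := Chr.sub_mem hL hu hv
      by_cases hde : IsI (β (u - v) (u - v) / 2)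
      · left; exact eq_Nb hsymm hN hNL huN hU1 hd hde
      · right
        refine eq_Nb hsymm hN hNL huN hU2 (Chr.sub_mem hL hu hva) ?_
        rw [← sub_sub]
        exact sub_even hsymm hL ha hd hao hde
    · rintro (rfl | rfl)
      · exact ⟨hU1, Nb_inter hsymm hL hv⟩
      · exact ⟨hU2, Nb_inter hsymm hL hva⟩
  · intro N hN hNL x hx
    rw [isI_half]
    by_cases hxL : x ∈ L
    · have : x ∈ ((N ⊓ L : Submodule ℤ (Fin h → ℚ)) : Set (Fin h → ℚ)) := ⟨hx, hxL⟩
      rw [hNL] at this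
      exact isI_half.1 this.2
    · exact hall x (chr_of_DM hsymm hL (DM_of_mem hN hNL hx) hxL)
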